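/- The number of monotone Boolean functions of 7 variables that are fixed points of the permutation of Fin 7 given by the product of transpositions (0 1)(2 3) equals 67922470. -/

import Mathlib

namespace FixedMBF

/-- The truth tables of the monotone functions of four variables fixed by `(0 1)(2 3)`. -/
def tables : List ℕ :=
  [0, 32768, 57344, 61440, 34944, 59520, 63616, 60096, 64192, 60576,
    64672, 61152, 65248, 65520, 34952, 59528, 63624, 60104, 64200, 60584,
    64680, 61160, 65256, 65528, 61166, 65262, 65534, 65535]

/-- Inclusion of bit sets. -/
def sub (m n : ℕ) : Bool := Nat.beq (Nat.land m n) m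

theorem sub_iff {m n : ℕ} : sub m n = true ↔ m &&& n = m :=
  iff_of_eq Nat.beq_eq

/-- `∑ a ∈ l, f a`, in a form that the kernel evaluates quickly. -/
def sumOn (l : List ℕ) (f : ℕ → ℕ) : ℕ :=
  List.rec 0 (fun a _ s => Nat.add (f a) s) l

/-- `List.filter`, in a form that the kernel evaluates quickly. -/
def filterOn (P : ℕ → Bool) (l : List ℕ) : List ℕ :=
  List.rec [] (fun a _ s => Bool.rec s (a :: s) (P a)) l

/-- The number of monotone maps from the three-dimensional cube to `l`. -/
def cubeCount (l : List ℕ) : ℕ :=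
  sumOn l fun q' =>
    (fun below => sumOn below fun q =>
      (fun between => sumOn below fun p' =>
        (fun below' => sumOn (filterOn (fun p => sub p q) below') fun p =>
          (fun c => Nat.mul c c)
            (sumOn (filterOn (fun r => sub p r) below') fun r =>
              sumOn (filterOn (fun s => sub r s) between) fun _ => 1))
        (filterOn (fun r => sub r p') l))
      (filterOn (fun s => sub q s) below))
    (filterOn (fun s => sub s q') l)

theorem cubeCount_tables : cubeCount tables = 67922470 := by
  decide +kernel

theorem sumOn_eq_sum (l : List ℕ) (f : ℕ → ℕ) : sumOn l f = (l.map f).sum := by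
  induction l with
  | nil => rfl
  | cons a l ih => rw [List.map_cons, List.sum_cons, ← ih]; rfl

theorem sumOn_filterOn (P : ℕ → Bool) (l : List ℕ) (f : ℕ → ℕ) :
    sumOn (filterOn P l) f = sumOn l fun a => if P a then f a else 0 := by
  induction l with
  | nil => rfl
  | cons a l ih =>
    have hcons (b : ℕ) (m : List ℕ) (g : ℕ → ℕ) : sumOn (b :: m) g = g b + sumOn m g := rfl
    have hfilter : filterOn P (a :: l) = Bool.rec (filterOn P l) (a :: filterOn P l) (P a) := rfl
    rw [hcons, hfilter, ← ih]
    cases P a <;> simp [hcons]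

theorem sumOn_eq_sum_subtype {l : List ℕ} (hl : l.Nodup) (f : ℕ → ℕ) :
    sumOn l f = ∑ a : {n // n ∈ l}, f a := by
  rw [sumOn_eq_sum, ← List.sum_toFinset f hl, ← Finset.sum_coe_sort]
  exact Fintype.sum_equiv (Equiv.subtypeEquivRight fun a => List.mem_toFinset) _ _ fun _ => rfl

/-- The function on the three-dimensional cube with given values at its corners. -/
def cubeMap {α : Type*} (p q p' q' r s r' s' : α) : Bool → Bool → Bool → α
  | false, false, false => p
  | true, false, false => q
  | false, true, true => p'
  | true, true, true => q'
  | false, true, false => r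
  | true, true, false => s
  | false, false, true => r'
  | true, false, true => s'

theorem cubeMap_monotone {α : Type*} [Preorder α] {p q p' q' r s r' s' : α}
    (hpq : p ≤ q) (hpq' : p' ≤ q') (hpr : p ≤ r) (hrp : r ≤ p') (hqs : q ≤ s) (hsq : s ≤ q')
    (hrs : r ≤ s) (hpr' : p ≤ r') (hrp' : r' ≤ p') (hqs' : q ≤ s') (hsq' : s' ≤ q')
    (hrs' : r' ≤ s') :
    Monotone fun y : Fin 3 → Bool => cubeMap p q p' q' r s r' s' (y 0) (y 1) (y 2) := by
  have h₀ (a a' b c : Bool) (h : a ≤ a') :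
      cubeMap p q p' q' r s r' s' a b c ≤ cubeMap p q p' q' r s r' s' a' b c := by
    revert h
    cases a <;> cases a' <;> cases b <;> cases c <;> intro h <;>
      first | exact le_rfl | assumption | exact absurd h (by decide)
  have h₁ (a b b' c : Bool) (h : b ≤ b') :
      cubeMap p q p' q' r s r' s' a b c ≤ cubeMap p q p' q' r s r' s' a b' c := by
    revert h
    cases a <;> cases b <;> cases b' <;> cases c <;> intro h <;>
      first | exact le_rfl | assumption | exact absurd h (by decide)
  have h₂ (a b c c' : Bool) (h : c ≤ c') :
      cubeMap p q p' q' r s r' s' a b c ≤ cubeMap p q p' q' r s r' s' a b c' := by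
    revert h
    cases a <;> cases b <;> cases c <;> cases c' <;> intro h <;>
      first | exact le_rfl | assumption | exact absurd h (by decide)
  exact fun y z h => ((h₀ _ _ _ _ (h 0)).trans (h₁ _ _ _ _ (h 1))).trans (h₂ _ _ _ _ (h 2))

/-- The comparable pairs with first entry in `[p, p']` and second entry in `[q, q']`. -/
abbrev MiddleEdge {α : Type*} [Preorder α] (p q p' q' : α) : Type _ :=
  {u : α × α // (u.1 ≤ p' ∧ p ≤ u.1) ∧ (u.2 ≤ q' ∧ q ≤ u.2) ∧ u.1 ≤ u.2}

/-- A monotone map on the three-dimensional cube amounts to its values on two opposite parallel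
edges together with its values on the two parallel edges in between. -/
def cubeEquiv (α : Type*) [Preorder α] :
    {F : (Fin 3 → Bool) → α // Monotone F} ≃
      Σ t : {t : α × α × α × α // t.2.1 ≤ t.1 ∧ t.2.2.1 ≤ t.1 ∧ t.2.2.2 ≤ t.2.2.1 ∧
          t.2.2.2 ≤ t.2.1},
        MiddleEdge t.1.2.2.2 t.1.2.1 t.1.2.2.1 t.1.1 ×
          MiddleEdge t.1.2.2.2 t.1.2.1 t.1.2.2.1 t.1.1 where
  toFun F :=
    have hF {x y : Fin 3 → Bool} (h : ∀ i, x i ≤ y i) : F.1 x ≤ F.1 y := F.2 h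
    ⟨⟨(F.1 ![true, true, true], F.1 ![true, false, false], F.1 ![false, true, true],
        F.1 ![false, false, false]),
      hF (by decide), hF (by decide), hF (by decide), hF (by decide)⟩,
      ⟨(F.1 ![false, true, false], F.1 ![true, true, false]),
        ⟨hF (by decide), hF (by decide)⟩, ⟨hF (by decide), hF (by decide)⟩,
        hF (by decide)⟩,
      ⟨(F.1 ![false, false, true], F.1 ![true, false, true]),
        ⟨hF (by decide), hF (by decide)⟩, ⟨hF (by decide), hF (by decide)⟩,
        hF (by decide)⟩⟩
  invFun e :=
    ⟨fun y => cubeMap e.1.1.2.2.2 e.1.1.2.1 e.1.1.2.2.1 e.1.1.1 e.2.1.1.1 e.2.1.1.2 e.2.2.1.1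
        e.2.2.1.2 (y 0) (y 1) (y 2),
      cubeMap_monotone e.1.2.2.2.2 e.1.2.2.1 e.2.1.2.1.2 e.2.1.2.1.1 e.2.1.2.2.1.2 e.2.1.2.2.1.1
        e.2.1.2.2.2 e.2.2.2.1.2 e.2.2.2.1.1 e.2.2.2.2.1.2 e.2.2.2.2.1.1 e.2.2.2.2.2⟩
  left_inv F := by
    apply Subtype.ext
    funext y
    have hy : y = ![y 0, y 1, y 2] := by ext i; fin_cases i <;> rfl
    rw [hy]
    generalize y 0 = a, y 1 = b, y 2 = c
    cases a <;> cases b <;> cases c <;> rfl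
  right_inv _ := rfl

theorem card_middleEdge {α : Type*} [Preorder α] [Fintype α] [DecidableLE α] (p q p' q' : α) :
    Nat.card (MiddleEdge p q p' q') =
      ∑ r : α, if r ≤ p' then if p ≤ r then
        ∑ s : α, if s ≤ q' then if q ≤ s then if r ≤ s then 1 else 0 else 0 else 0
        else 0 else 0 := by
  rw [Nat.card_eq_fintype_card, Fintype.card_subtype, Finset.card_filter, Fintype.sum_prod_type]
  simp only [ite_and, Finset.sum_ite_irrel, Finset.sum_const_zero]

theorem card_cube (α : Type*) [Preorder α] [Fintype α] [DecidableLE α] :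
    Nat.card {F : (Fin 3 → Bool) → α // Monotone F} =
      ∑ q' : α, ∑ q : α, if q ≤ q' then ∑ p' : α, if p' ≤ q' then
        ∑ p : α, if p ≤ p' then if p ≤ q then
          (∑ r : α, if r ≤ p' then if p ≤ r then
            ∑ s : α, if s ≤ q' then if q ≤ s then if r ≤ s then 1 else 0 else 0 else 0
            else 0 else 0) ^ 2 else 0 else 0 else 0 else 0 := by
  rw [Nat.card_congr (cubeEquiv α), Nat.card_sigma]
  simp only [Nat.card_prod, card_middleEdge, ← sq]
  rw [← Finset.sum_subtype (Finset.univ.filter fun t : α × α × α × α => t.2.1 ≤ t.1 ∧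
    t.2.2.1 ≤ t.1 ∧ t.2.2.2 ≤ t.2.2.1 ∧ t.2.2.2 ≤ t.2.1) (by simp) fun t : α × α × α × α =>
      (∑ r : α, if r ≤ t.2.2.1 then if t.2.2.2 ≤ r then
        ∑ s : α, if s ≤ t.1 then if t.2.1 ≤ s then if r ≤ s then 1 else 0 else 0 else 0
        else 0 else 0) ^ 2, Finset.sum_filter]
  simp only [Fintype.sum_prod_type, ite_and, Finset.sum_ite_irrel, Finset.sum_const_zero]

/-- The permutation `(0 1)(2 3)` of four variables. -/
def doubleSwap : Equiv.Perm (Fin 4) := Equiv.swap 0 1 * Equiv.swap 2 3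

/-- Monotone functions of four variables fixed by `(0 1)(2 3)`. -/
abbrev Fixed : Type :=
  {h : (Fin 4 → Bool) → Bool // Monotone h ∧ ∀ x, h (x ∘ doubleSwap) = h x}

/-- The position of an input in a truth table. -/
def position (x : Fin 4 → Bool) : ℕ :=
  (x 0).toNat + 2 * (x 1).toNat + 4 * (x 2).toNat + 8 * (x 3).toNat

theorem exists_position_eq : ∀ i < 16, ∃ x, position x = i := by decide

theorem testBit_position_mono : ∀ n ∈ tables, Monotone fun x => n.testBit (position x) := by
  have h : ∀ n ∈ tables, ∀ x y : Fin 4 → Bool, (∀ i, x i ≤ y i) →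
      n.testBit (position x) ≤ n.testBit (position y) := by
    decide +kernel
  exact fun n hn x y hxy => h n hn x y hxy

theorem testBit_position_comp :
    ∀ n ∈ tables, ∀ x, n.testBit (position (x ∘ doubleSwap)) = n.testBit (position x) := by
  decide +kernel

/-- The function with a given truth table. -/
def ofTable (n : {n // n ∈ tables}) : Fixed :=
  ⟨fun x => n.1.testBit (position x), testBit_position_mono n n.2, testBit_position_comp n n.2⟩

theorem ofTable_le_iff (m n : {n // n ∈ tables}) : ofTable m ≤ ofTable n ↔ sub m n = true := by
  have hlt : ∀ n ∈ tables, n < 2 ^ 16 := by decide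
  rw [sub_iff]
  constructor
  · intro h
    refine Nat.eq_of_testBit_eq fun i => ?_
    rw [Nat.testBit_and]
    by_cases hi : i < 16
    · obtain ⟨x, rfl⟩ := exists_position_eq i hi
      have hx : m.1.testBit (position x) ≤ n.1.testBit (position x) := h x
      revert hx
      cases m.1.testBit (position x) <;> cases n.1.testBit (position x) <;> decide
    · have : m.1.testBit i = false :=
        Nat.testBit_lt_two_pow ((hlt m m.2).trans_le (Nat.pow_le_pow_right two_pos (by omega)))
      rw [this, Bool.false_and]
  · intro h x
    change m.1.testBit (position x) ≤ n.1.testBit (position x)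
    rw [← h, Nat.testBit_and]
    exact inf_le_right

/-- The truth table with given values on the orbits of `(0 1)(2 3)`. -/
def orbitTable (b₀ b₁ b₃ b₄ b₅ b₆ b₇ b₁₂ b₁₃ b₁₅ : Bool) : ℕ :=
  Nat.ofBits fun i : Fin 16 =>
    ![b₀, b₁, b₁, b₃, b₄, b₅, b₆, b₇, b₄, b₆, b₅, b₇, b₁₂, b₁₃, b₁₃, b₁₅] i

theorem orbitTable_mem : ∀ b₀ b₁ b₃ b₄ b₅ b₆ b₇ b₁₂ b₁₃ b₁₅ : Bool,
    b₀ ≤ b₁ → b₀ ≤ b₄ → b₁ ≤ b₃ → b₁ ≤ b₅ → b₁ ≤ b₆ → b₄ ≤ b₅ → b₄ ≤ b₆ → b₄ ≤ b₁₂ →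
    b₃ ≤ b₇ → b₅ ≤ b₇ → b₆ ≤ b₇ → b₅ ≤ b₁₃ → b₆ ≤ b₁₃ → b₁₂ ≤ b₁₃ → b₇ ≤ b₁₅ → b₁₃ ≤ b₁₅ →
    orbitTable b₀ b₁ b₃ b₄ b₅ b₆ b₇ b₁₂ b₁₃ b₁₅ ∈ tables := by
  decide +kernel

theorem ofTable_surjective : Function.Surjective ofTable := by
  rintro ⟨h, hmono, hfix⟩
  have hswap (a b c d : Bool) : h ![b, a, d, c] = h ![a, b, c, d] := by
    rw [← hfix]
    congr 1
    ext i
    fin_cases i <;> rfl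
  have hle {x y : Fin 4 → Bool} (hxy : ∀ i, x i ≤ y i) : h x ≤ h y := hmono hxy
  refine ⟨⟨orbitTable (h ![false, false, false, false]) (h ![true, false, false, false])
    (h ![true, true, false, false]) (h ![false, false, true, false])
    (h ![true, false, true, false]) (h ![false, true, true, false])
    (h ![true, true, true, false]) (h ![false, false, true, true])
    (h ![true, false, true, true]) (h ![true, true, true, true]), ?_⟩, ?_⟩
  · apply orbitTable_mem <;> first
      | exact hle (by decide)
      | (rw [← hswap]; exact hle (by decide))
  · apply Subtype.ext
    funext x
    have hx : x = ![x 0, x 1, x 2, x 3] := by ext i; fin_cases i <;> rfl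
    rw [hx]
    generalize x 0 = a, x 1 = b, x 2 = c, x 3 = d
    cases a <;> cases b <;> cases c <;> cases d <;>
      refine (Nat.testBit_ofBits_lt _ _ (by decide)).trans ?_
    all_goals first
      | rfl
      | exact (hswap _ _ _ _).symm

theorem ofTable_injective : Function.Injective ofTable := by
  intro m n hmn
  have h₁ : m.1 &&& n.1 = m.1 := sub_iff.1 ((ofTable_le_iff m n).1 hmn.le)
  have h₂ : n.1 &&& m.1 = n.1 := sub_iff.1 ((ofTable_le_iff n m).1 hmn.ge)
  exact Subtype.ext (by rw [← h₁, Nat.land_comm, h₂])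

theorem card_cube_fixed :
    Nat.card {F : (Fin 3 → Bool) → Fixed // Monotone F} = cubeCount tables := by
  classical
  have hsum (g : Fixed → ℕ) : ∑ a, g a = ∑ n, g (ofTable n) :=
    (Function.Bijective.sum_comp ⟨ofTable_injective, ofTable_surjective⟩ g).symm
  have htables : tables.Nodup := by decide
  rw [card_cube]
  simp only [cubeCount, sumOn_filterOn, Nat.mul_eq, ← sq, sumOn_eq_sum_subtype htables, hsum,
    ofTable_le_iff]

/-- Splitting the seven variables into the first four and the last three. -/
def splitEquiv :
    {f : (Fin 7 → Bool) → Bool // Monotone f ∧ ∀ x : Fin 7 → Bool,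
      f (x ∘ (Equiv.swap 0 1 * Equiv.swap 2 3 : Equiv.Perm (Fin 7))) = f x} ≃
    {F : (Fin 3 → Bool) → Fixed // Monotone F} where
  toFun f :=
    ⟨fun y => ⟨fun x => f.1 (Fin.append x y), fun x x' h => f.2.1 (by
        refine fun i => Fin.addCases (m := 4) (n := 3) (fun j => ?_) (fun j => ?_) i
        · simpa using h j
        · simp), fun x => by
        refine Eq.trans (congrArg f.1 ?_) (f.2.2 (Fin.append x y))
        ext i
        fin_cases i <;> rfl⟩,
      fun y y' h x => f.2.1 (by
        refine fun i => Fin.addCases (m := 4) (n := 3) (fun j => ?_) (fun j => ?_) i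
        · simp
        · simpa using h j)⟩
  invFun F :=
    ⟨fun z => (F.1 fun j => z (Fin.natAdd 4 j)).1 fun i => z (Fin.castAdd 3 i),
      fun z z' h => (F.2 (fun j => h (Fin.natAdd 4 j)) _).trans
        ((F.1 _).2.1 fun i => h (Fin.castAdd 3 i)), fun z => by
        refine Eq.trans ?_ ((F.1 fun j => z (Fin.natAdd 4 j)).2.2 _)
        have hy : (fun j : Fin 3 => (z ∘ (Equiv.swap 0 1 * Equiv.swap 2 3 : Equiv.Perm (Fin 7)))
            (Fin.natAdd 4 j : Fin (4 + 3))) = fun j : Fin 3 => z (Fin.natAdd 4 j) := by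
          ext j
          fin_cases j <;> rfl
        dsimp only
        rw [hy]
        refine congrArg (F.1 _).1 (funext fun i => ?_)
        fin_cases i <;> rfl⟩
  left_inv f := by
    apply Subtype.ext
    funext z
    exact congrArg f.1 (Fin.append_castAdd_natAdd (m := 4) (n := 3) (f := z))
  right_inv F := by
    apply Subtype.ext
    funext y
    apply Subtype.ext
    funext x
    simp

end FixedMBF

theorem card_fixed_mbf :
    Nat.card {f : (Fin 7 → Bool) → Bool //
      Monotone f ∧ ∀ x : Fin 7 → Bool, f (x ∘ (Equiv.swap 0 1 * Equiv.swap 2 3 : Equiv.Perm (Fin 7))) = f x} = 67922470 := by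
  rw [Nat.card_congr FixedMBF.splitEquiv, FixedMBF.card_cube_fixed, FixedMBF.cubeCount_tables]
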